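/- arXiv:1007.1764 — 2 statements merged into one kernel-verified Lean document; each statement's English description precedes it below -/
import Mathlib

section
/- For all integers n ≥ 1 and 0 ≤ l ≤ n−1, the Appell property ∂₀A_n^l = n·A_{n−1}^l holds on ℝ³; moreover ∂₀A_n^n = 0 on ℝ³ for every n ≥ 0, i.e. the polynomials A_n^n are monogenic constants. -/
open MeasureTheory Metric Finset

noncomputable section

/-- `ℝ³` with the Euclidean norm and Lebesgue measure. -/
abbrev R3 := EuclideanSpace ℝ (Fin 3)
/-- the real quaternions ℍ -/
abbrev QH := Quaternion ℝ

/-- the basis quaternion e₁ -/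
def e1 : QH := ⟨0,1,0,0⟩
/-- the basis quaternion e₂ -/
def e2 : QH := ⟨0,0,1,0⟩
/-- the basis quaternion e₃ -/
def e3 : QH := ⟨0,0,0,1⟩

/-- embed a point of ℝ³ as the reduced quaternion x₀ + x₁e₁ + x₂e₂ -/
def toQ (x : R3) : QH := ⟨x 0, x 1, x 2, 0⟩
/-- the conjugate reduced quaternion x₀ - x₁e₁ - x₂e₂ -/
def toQbar (x : R3) : QH := ⟨x 0, -(x 1), -(x 2), 0⟩
/-- ζ = x₁ - x₂e₃ -/
def zeta (x : R3) : QH := ⟨x 1, 0, 0, -(x 2)⟩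

/-- build a point of ℝ³ from coordinates -/
def mk3 (a b c : ℝ) : R3 := (WithLp.equiv 2 (Fin 3 → ℝ)).symm ![a, b, c]

/-- the conjugated point (x₀, -x₁, -x₂) -/
def barPt (x : R3) : R3 := mk3 (x 0) (-(x 1)) (-(x 2))

/-- partial derivative ∂f/∂xᵢ -/
def pd (i : Fin 3) (f : R3 → QH) (x : R3) : QH :=
  fderiv ℝ f x (EuclideanSpace.single i 1)

/-- the generalized Cauchy-Riemann operator ∂̄f = ∂f/∂x₀ + e₁∂f/∂x₁ + e₂∂f/∂x₂ -/
def CRbar (f : R3 → QH) (x : R3) : QH :=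
  pd 0 f x + e1 * pd 1 f x + e2 * pd 2 f x

/-- the adjoint generalized Cauchy-Riemann operator ∂f = ∂f/∂x₀ - e₁∂f/∂x₁ - e₂∂f/∂x₂ -/
def Dadj (f : R3 → QH) (x : R3) : QH :=
  pd 0 f x - e1 * pd 1 f x - e2 * pd 2 f x

/-- the hypercomplex derivative ∂₀ = (1/2)∂ -/
def D0 (f : R3 → QH) : R3 → QH := fun x =>
  (1/2 : ℝ) • (pd 0 f x - e1 * pd 1 f x - e2 * pd 2 f x)

/-- the operator ∂̄_ℂ f = (1/2)(∂f/∂x₁ + e₃∂f/∂x₂) -/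
def DbarC (f : R3 → QH) : R3 → QH := fun x =>
  (1/2 : ℝ) • (pd 1 f x + e3 * pd 2 f x)

/-- the involution f⁰ + f¹e₁ + f²e₂ + f³e₃ ↦ f⁰ - f¹e₁ - f²e₂ + f³e₃ -/
def invol (a : QH) : QH := ⟨a.re, -a.imI, -a.imJ, a.imK⟩

/-- the inner Appell polynomial A_n^l -/
def appell (n l : ℕ) (x : R3) : QH :=
  ((n.factorial * l.factorial : ℝ) /
      (2 ^ (2 * (n - l)) * (n + l + 1).factorial * (2 * l).factorial)) •
    ((∑ h ∈ Finset.range (n - l + 1),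
        (((2 * n - 2 * h + 1).factorial * (2 * l + 2 * h).factorial : ℝ) /
            (h.factorial * (n - l - h).factorial * (n - h).factorial * (l + h).factorial)) •
          (toQbar x ^ h * toQ x ^ (n - l - h))) * zeta x ^ l)

/-- the Kelvin transform K(P)(x) = (x̄/|x|³)·P(x̄/|x|²) -/
def kelvin (P : R3 → QH) (x : R3) : QH :=
  ((‖x‖ ^ 3)⁻¹ • toQbar x) * P ((‖x‖ ^ 2)⁻¹ • barPt x)

/-- the outer Appell function A_{-(n+2)}^l -/
def outerAppell (n l : ℕ) (x : R3) : QH :=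
  (((n + l + 1).factorial * (n - l).factorial : ℝ) / (n.factorial * (n + 1).factorial)) •
    kelvin (appell n l) x

/-- surface integral over the sphere of radius ρ (parametrized by the unit sphere
with its surface measure, with the Jacobian factor ρ²) -/
def sphereIntegral (ρ : ℝ) (g : R3 → QH) : QH :=
  ∫ ω : sphere (0 : R3) 1, (ρ ^ 2) • g (ρ • (ω : R3)) ∂((volume : Measure R3).toSphere)

/-- the unified family ψ_k^l, k ∈ ℤ \ {-1}: inner Appell polynomials for k ≥ 0,
outer Appell functions for k ≤ -2 -/
def psiFam (k : ℤ) (l : ℕ) (x : R3) : QH :=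
  if 0 ≤ k then appell k.toNat l x else outerAppell (-k - 2).toNat l x

@[simp] lemma toQ_re (x : R3) : (toQ x).re = x 0 := rfl
@[simp] lemma toQ_imI (x : R3) : (toQ x).imI = x 1 := rfl
@[simp] lemma toQ_imJ (x : R3) : (toQ x).imJ = x 2 := rfl
@[simp] lemma toQ_imK (x : R3) : (toQ x).imK = 0 := rfl
@[simp] lemma toQbar_re (x : R3) : (toQbar x).re = x 0 := rfl
@[simp] lemma toQbar_imI (x : R3) : (toQbar x).imI = -(x 1) := rfl
@[simp] lemma toQbar_imJ (x : R3) : (toQbar x).imJ = -(x 2) := rfl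
@[simp] lemma toQbar_imK (x : R3) : (toQbar x).imK = 0 := rfl
@[simp] lemma zeta_re (x : R3) : (zeta x).re = x 1 := rfl
@[simp] lemma zeta_imI (x : R3) : (zeta x).imI = 0 := rfl
@[simp] lemma zeta_imJ (x : R3) : (zeta x).imJ = 0 := rfl
@[simp] lemma zeta_imK (x : R3) : (zeta x).imK = -(x 2) := rfl
@[simp] lemma e1_re : e1.re = 0 := rfl
@[simp] lemma e1_imI : e1.imI = 1 := rfl
@[simp] lemma e1_imJ : e1.imJ = 0 := rfl
@[simp] lemma e1_imK : e1.imK = 0 := rfl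
@[simp] lemma e2_re : e2.re = 0 := rfl
@[simp] lemma e2_imI : e2.imI = 0 := rfl
@[simp] lemma e2_imJ : e2.imJ = 1 := rfl
@[simp] lemma e2_imK : e2.imK = 0 := rfl

/-- `toQ` as a continuous linear map. -/
def toQCLM : R3 →L[ℝ] QH :=
  LinearMap.toContinuousLinearMap
    { toFun := toQ
      map_add' := fun x y => by ext <;> simp
      map_smul' := fun c x => by ext <;> simp }

/-- `toQbar` as a continuous linear map. -/
def toQbarCLM : R3 →L[ℝ] QH :=
  LinearMap.toContinuousLinearMap
    { toFun := toQbar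
      map_add' := fun x y => by ext <;> simp [add_comm]
      map_smul' := fun c x => by ext <;> simp }

/-- `zeta` as a continuous linear map. -/
def zetaCLM : R3 →L[ℝ] QH :=
  LinearMap.toContinuousLinearMap
    { toFun := zeta
      map_add' := fun x y => by ext <;> simp [add_comm]
      map_smul' := fun c x => by ext <;> simp }

lemma differentiable_toQ : Differentiable ℝ toQ := toQCLM.differentiable
lemma differentiable_toQbar : Differentiable ℝ toQbar := toQbarCLM.differentiable
lemma differentiable_zeta : Differentiable ℝ zeta := zetaCLM.differentiable

lemma pd_toQ (i : Fin 3) (x : R3) : pd i toQ x = toQ (EuclideanSpace.single i 1) :=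
  congrArg (fun L : R3 →L[ℝ] QH => L (EuclideanSpace.single i 1)) (toQCLM.fderiv (x := x))

lemma pd_toQbar (i : Fin 3) (x : R3) : pd i toQbar x = toQbar (EuclideanSpace.single i 1) :=
  congrArg (fun L : R3 →L[ℝ] QH => L (EuclideanSpace.single i 1)) (toQbarCLM.fderiv (x := x))

lemma pd_zeta (i : Fin 3) (x : R3) : pd i zeta x = zeta (EuclideanSpace.single i 1) :=
  congrArg (fun L : R3 →L[ℝ] QH => L (EuclideanSpace.single i 1)) (zetaCLM.fderiv (x := x))

lemma pd_mul (i : Fin 3) {f g : R3 → QH} (hf : Differentiable ℝ f) (hg : Differentiable ℝ g)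
    (x : R3) : pd i (fun y => f y * g y) x = f x * pd i g x + pd i f x * g x := by
  unfold pd
  rw [fderiv_fun_mul' (hf x) (hg x)]
  simp

/-- The first-order operator `x̲ ∂/∂x₀ + x₁ ∂/∂x₁ + x₂ ∂/∂x₂`, with `x̲ = x₁e₁ + x₂e₂`. -/
def vecEuler (f : R3 → QH) (x : R3) : QH :=
  (x 1 • e1 + x 2 • e2) * pd 0 f x + x 1 • pd 1 f x + x 2 • pd 2 f x

lemma Dadj_toQ_mul {f : R3 → QH} (hf : Differentiable ℝ f) (x : R3) :
    Dadj (fun y => toQ y * f y) x =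
      (3 : ℝ) • f x + toQbar x * Dadj f x + (2 : ℝ) • vecEuler f x := by
  simp only [Dadj, vecEuler, pd_mul _ differentiable_toQ hf, pd_toQ]
  ext <;> simp <;> ring

lemma Dadj_toQbar_mul {f : R3 → QH} (hf : Differentiable ℝ f) (x : R3) :
    Dadj (fun y => toQbar y * f y) x =
      -f x + toQ x * Dadj f x - (2 : ℝ) • vecEuler f x := by
  simp only [Dadj, vecEuler, pd_mul _ differentiable_toQbar hf, pd_toQbar]
  ext <;> simp <;> ring

lemma Dadj_zeta_mul {f : R3 → QH} (hf : Differentiable ℝ f) (x : R3) :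
    Dadj (fun y => zeta y * f y) x =
      zeta x * pd 0 f x + star (zeta x) * (Dadj f x - pd 0 f x) := by
  simp only [Dadj, pd_mul _ differentiable_zeta hf, pd_zeta]
  ext <;> simp <;> ring

lemma vecEuler_toQ_mul {f : R3 → QH} (hf : Differentiable ℝ f) (x : R3) :
    vecEuler (fun y => toQ y * f y) x = (toQ x - toQbar x) * f x + toQ x * vecEuler f x := by
  simp only [vecEuler, pd_mul _ differentiable_toQ hf, pd_toQ]
  ext <;> simp <;> ring

lemma vecEuler_toQbar_mul {f : R3 → QH} (hf : Differentiable ℝ f) (x : R3) :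
    vecEuler (fun y => toQbar y * f y) x = toQbar x * vecEuler f x := by
  simp only [vecEuler, pd_mul _ differentiable_toQbar hf, pd_toQbar]
  ext <;> simp <;> ring

lemma differentiable_zeta_pow (l : ℕ) : Differentiable ℝ (fun y => zeta y ^ l) :=
  differentiable_zeta.pow l

lemma pd_zero_zeta_pow (l : ℕ) (x : R3) : pd 0 (fun y => zeta y ^ l) x = 0 := by
  induction l with
  | zero => simp [pd]
  | succ l ih =>
    simp only [pow_succ']
    rw [pd_mul _ differentiable_zeta (differentiable_zeta_pow l), ih, pd_zeta]
    have : zeta (EuclideanSpace.single 0 1) = 0 := by ext <;> simp <;> rfl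
    simp [this]

lemma Dadj_zeta_pow (l : ℕ) (x : R3) : Dadj (fun y => zeta y ^ l) x = 0 := by
  induction l with
  | zero => simp [Dadj, pd]
  | succ l ih =>
    simp only [pow_succ']
    rw [Dadj_zeta_mul (differentiable_zeta_pow l), ih, pd_zero_zeta_pow]
    simp

lemma vecEuler_zeta_pow (l : ℕ) (x : R3) :
    vecEuler (fun y => zeta y ^ l) x = (l : ℝ) • zeta x ^ l := by
  induction l with
  | zero => simp [vecEuler, pd]
  | succ l ih =>
    have hz : x 1 • zeta (EuclideanSpace.single 1 1) + x 2 • zeta (EuclideanSpace.single 2 1)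
        = zeta x := by ext <;> simp
    simp only [vecEuler, pd_zero_zeta_pow, mul_zero, zero_add] at ih
    simp only [vecEuler, pd_zero_zeta_pow, mul_zero, zero_add]
    simp only [pow_succ']
    simp only [pd_mul _ differentiable_zeta (differentiable_zeta_pow l), pd_zeta]
    calc _ = zeta x * (x 1 • pd 1 (fun y => zeta y ^ l) x + x 2 • pd 2 (fun y => zeta y ^ l) x)
          + (x 1 • zeta (EuclideanSpace.single 1 1) + x 2 • zeta (EuclideanSpace.single 2 1))
            * zeta x ^ l := by
          simp only [smul_add, mul_add, add_mul, mul_smul_comm, smul_mul_assoc]; abel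
      _ = _ := by
          rw [ih, hz, mul_smul_comm]; push_cast; rw [add_smul, one_smul]

open Polynomial in
/-- `x` and `x̄` generate a commutative subalgebra, parametrized here by real polynomials. -/
lemma aeval_toQ_conj (x : R3) : aeval (toQ x) (C (2 * x 0) - X : ℝ[X]) = toQbar x := by
  rw [map_sub, aeval_C, aeval_X]
  ext <;> simp [Quaternion.algebraMap_def]
  ring

open Polynomial in
lemma exists_aeval_eq (x : R3) :
    ∃ (φ : ℝ[X] →ₐ[ℝ] QH) (a b : ℝ[X]), toQbar x = φ a ∧ toQ x = φ b :=
  ⟨aeval (toQ x), _, X, (aeval_toQ_conj x).symm, (aeval_X _).symm⟩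

/-- The homogeneous sum `∑_{i<k} aⁱ b^{k-1-i}`, as a recursion. -/
def geomSum {R : Type*} [Semiring R] (a b : R) : ℕ → R
  | 0 => 0
  | k + 1 => b ^ k + a * geomSum a b k

lemma map_geomSum {R S F : Type*} [Semiring R] [Semiring S] [FunLike F R S]
    [RingHomClass F R S] (φ : F) (a b : R) (k : ℕ) :
    φ (geomSum a b k) = geomSum (φ a) (φ b) k := by
  induction k with
  | zero => simp [geomSum]
  | succ k ih => simp [geomSum, ih]

lemma mul_geomSum {R : Type*} [CommRing R] (a b : R) (k : ℕ) :
    b * geomSum a b k = a * geomSum a b k + b ^ k - a ^ k := by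
  induction k with
  | zero => simp [geomSum]
  | succ k ih =>
    simp only [geomSum]
    linear_combination a * ih

lemma geomSum_step {R : Type*} [CommRing R] (a b : R) (h k : ℕ) :
    b * (a ^ h * geomSum a b k - a ^ k * geomSum a b h) - a ^ h * b ^ k =
      a ^ (h + 1) * geomSum a b k - a ^ k * geomSum a b (h + 1) := by
  simp only [geomSum]
  linear_combination a ^ h * mul_geomSum a b k - a ^ k * mul_geomSum a b h


lemma differentiable_toQ_pow_mul (k l : ℕ) :
    Differentiable ℝ (fun y => toQ y ^ k * zeta y ^ l) :=
  (differentiable_toQ.pow k).mul (differentiable_zeta_pow l)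

lemma differentiable_monomial (h k l : ℕ) :
    Differentiable ℝ (fun y => toQbar y ^ h * (toQ y ^ k * zeta y ^ l)) :=
  (differentiable_toQbar.pow h).mul (differentiable_toQ_pow_mul k l)

lemma vecEuler_toQ_pow_mul (k l : ℕ) (x : R3) :
    vecEuler (fun y => toQ y ^ k * zeta y ^ l) x =
      ((k : ℝ) • ((toQ x - toQbar x) * toQ x ^ (k - 1)) + (l : ℝ) • toQ x ^ k) * zeta x ^ l := by
  induction k with
  | zero => simp [vecEuler_zeta_pow]
  | succ k ih =>
    simp only [pow_succ', mul_assoc]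
    rw [vecEuler_toQ_mul (differentiable_toQ_pow_mul k l), ih]
    simp only [← mul_assoc, ← add_mul]
    congr 1
    obtain ⟨φ, a, b, ha, hb⟩ := exists_aeval_eq x
    rw [ha, hb]
    simp only [← map_mul, ← map_pow, ← map_add, ← map_sub, ← map_smul]
    congr 1
    simp only [Polynomial.smul_eq_C_mul]
    rcases k with _ | k
    · simp; ring
    · simp; ring

lemma vecEuler_monomial (h k l : ℕ) (x : R3) :
    vecEuler (fun y => toQbar y ^ h * (toQ y ^ k * zeta y ^ l)) x =
      toQbar x ^ h *
        (((k : ℝ) • ((toQ x - toQbar x) * toQ x ^ (k - 1)) + (l : ℝ) • toQ x ^ k)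
          * zeta x ^ l) := by
  induction h with
  | zero => simp [vecEuler_toQ_pow_mul]
  | succ h ih =>
    simp only [pow_succ', mul_assoc]
    rw [vecEuler_toQbar_mul (differentiable_monomial h k l), ih]

lemma Dadj_toQ_pow_mul (k l : ℕ) (x : R3) :
    Dadj (fun y => toQ y ^ k * zeta y ^ l) x =
      ((2 * k : ℝ) • toQ x ^ (k - 1) + (2 * l + 1 : ℝ) • geomSum (toQbar x) (toQ x) k)
        * zeta x ^ l := by
  induction k with
  | zero => simp [Dadj_zeta_pow, geomSum]
  | succ k ih =>
    simp only [pow_succ', mul_assoc]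
    rw [Dadj_toQ_mul (differentiable_toQ_pow_mul k l), ih, vecEuler_toQ_pow_mul]
    simp only [← mul_assoc, ← smul_mul_assoc, ← add_mul]
    congr 1
    obtain ⟨φ, a, b, ha, hb⟩ := exists_aeval_eq x
    rw [ha, hb]
    simp only [← map_geomSum, ← map_mul, ← map_pow, ← map_add, ← map_sub, ← map_smul]
    congr 1
    simp only [Polynomial.smul_eq_C_mul, geomSum]
    rcases k with _ | k
    · simp [map_ofNat Polynomial.C 2, map_ofNat Polynomial.C 3]; ring
    · simp [map_ofNat Polynomial.C 2, map_ofNat Polynomial.C 3]; ring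

/-- The adjoint Cauchy-Riemann operator on `x̄ʰ xᵏ ζˡ`. -/
lemma Dadj_monomial (h k l : ℕ) (x : R3) :
    Dadj (fun y => toQbar y ^ h * (toQ y ^ k * zeta y ^ l)) x =
      ((2 * k : ℝ) • (toQbar x ^ h * toQ x ^ (k - 1)) +
        (2 * l + 1 : ℝ) • (toQbar x ^ h * geomSum (toQbar x) (toQ x) k
          - toQbar x ^ k * geomSum (toQbar x) (toQ x) h)) * zeta x ^ l := by
  induction h with
  | zero => simp [Dadj_toQ_pow_mul, geomSum]
  | succ h ih =>
    simp only [pow_succ' _ h, mul_assoc (toQbar _) (toQbar _ ^ h)]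
    rw [Dadj_toQbar_mul (differentiable_monomial h k l), ih, vecEuler_monomial]
    simp only [← mul_assoc, ← smul_mul_assoc, ← neg_mul, ← add_mul, ← sub_mul]
    congr 1
    obtain ⟨φ, a, b, ha, hb⟩ := exists_aeval_eq x
    rw [ha, hb]
    simp only [← map_geomSum, ← map_mul, ← map_pow, ← map_add, ← map_sub, ← map_smul, ← map_neg]
    congr 1
    have hg := geomSum_step a b h k
    simp only [Polynomial.smul_eq_C_mul]
    rcases k with _ | k
    · simp [map_ofNat Polynomial.C 2] at hg ⊢; linear_combination (2 * (l : Polynomial ℝ) + 1) * hg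
    · simp [map_ofNat Polynomial.C 2] at hg ⊢; linear_combination (2 * (l : Polynomial ℝ) + 1) * hg

/-- The coefficients `(2(l+h))! / (h! (l+h)!)`. -/
def halfCoeff (l h : ℕ) : ℝ := (2 * (l + h)).factorial / (h.factorial * (l + h).factorial)

lemma halfCoeff_succ (l h : ℕ) :
    (h + 1 : ℝ) * halfCoeff l (h + 1) = 2 * (2 * l + 2 * h + 1) * halfCoeff l h := by
  unfold halfCoeff
  rw [show 2 * (l + (h + 1)) = 2 * (l + h) + 1 + 1 by ring, ← add_assoc]
  simp only [Nat.factorial_succ]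
  push_cast
  field_simp
  ring

/-- The coefficients of `x̄ʰ xᵏ` in the Appell polynomials, up to normalization. -/
def appellCoeff (l h k : ℕ) : ℝ := (2 * l + 2 * k + 1) * halfCoeff l h * halfCoeff l k

lemma appell_eq (l m : ℕ) :
    appell (l + m) l = fun x =>
      (((l + m).factorial * l.factorial : ℝ) /
        (2 ^ (2 * m) * (l + m + l + 1).factorial * (2 * l).factorial)) •
      ∑ h ∈ range (m + 1), appellCoeff l h (m - h) •
        (toQbar x ^ h * (toQ x ^ (m - h) * zeta x ^ l)) := by
  funext x
  unfold appell
  rw [Nat.add_sub_cancel_left, Finset.sum_mul]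
  congr 1
  refine Finset.sum_congr rfl fun h hh => ?_
  obtain ⟨k, rfl⟩ := Nat.exists_eq_add_of_le (Nat.lt_succ_iff.mp (mem_range.mp hh))
  rw [smul_mul_assoc, mul_assoc (toQbar x ^ h)]
  congr 1
  rw [show 2 * (l + (h + k)) - 2 * h + 1 = 2 * (l + k) + 1 by omega,
    show l + (h + k) - h = l + k by omega, show 2 * l + 2 * h = 2 * (l + h) by ring,
    Nat.add_sub_cancel_left, Nat.factorial_succ, appellCoeff, halfCoeff, halfCoeff]
  push_cast
  field_simp

/-- Summation by parts. -/
lemma sum_range_sub_smul {E : Type*} [AddCommGroup E] [Module ℝ E] (r : ℕ → ℝ) (H M : ℕ → E)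
    (h0 : r 0 = 0) (m : ℕ) (hH : ∀ j < m, H j = M j + H (j + 1)) :
    ∑ h ∈ range m, (r (h + 1) - r h) • H h = ∑ h ∈ range m, r (h + 1) • M h + r m • H m := by
  induction m with
  | zero => simp [h0]
  | succ m ih =>
    rw [sum_range_succ, sum_range_succ, ih fun j hj => hH j (by omega), hH m (by omega)]
    module

lemma sum_geomSum {m : ℕ} (l : ℕ) (a b : QH) :
    ∑ h ∈ range (m + 2), appellCoeff l h (m + 1 - h) •
      (((2 * (m + 1 - h : ℕ) : ℝ)) • (a ^ h * b ^ (m + 1 - h - 1)) +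
        (2 * l + 1 : ℝ) • (a ^ h * geomSum a b (m + 1 - h) - a ^ (m + 1 - h) * geomSum a b h)) =
    (8 * (2 * l + m + 2) : ℝ) • ∑ h ∈ range (m + 1), appellCoeff l h (m - h) •
      (a ^ h * b ^ (m - h)) := by
  have hrefl : ∑ h ∈ range (m + 2), appellCoeff l h (m + 1 - h) •
        (a ^ (m + 1 - h) * geomSum a b h) =
      ∑ h ∈ range (m + 2), appellCoeff l (m + 1 - h) h • (a ^ h * geomSum a b (m + 1 - h)) := by
    rw [← sum_range_reflect]
    refine sum_congr rfl fun h hh => ?_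
    have := mem_range.mp hh
    rw [show m + 2 - 1 - h = m + 1 - h by omega, show m + 1 - (m + 1 - h) = h by omega]
  have hparts := sum_range_sub_smul
    (fun h => (h * halfCoeff l h) * ((m + 1 - h + 1 : ℕ) * halfCoeff l (m + 1 - h + 1)))
    (fun h => a ^ h * geomSum a b (m + 1 - h)) (fun h => a ^ h * b ^ (m - h)) (by simp) (m + 1)
    (fun j hj => by
      rw [show m + 1 - j = m - j + 1 by omega, show m + 1 - (j + 1) = m - j by omega,
        geomSum, mul_add, pow_succ, mul_assoc])
  have hsplit : ∀ h ∈ range (m + 1),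
      appellCoeff l h (m + 1 - h) • ((2 * (m + 1 - h : ℕ) : ℝ) • (a ^ h * b ^ (m + 1 - h - 1))) +
        ((h + 1 : ℕ) * halfCoeff l (h + 1) *
          ((m + 1 - (h + 1) + 1 : ℕ) * halfCoeff l (m + 1 - (h + 1) + 1))) •
          (a ^ h * b ^ (m - h)) =
      (8 * (2 * l + m + 2) : ℝ) • appellCoeff l h (m - h) • (a ^ h * b ^ (m - h)) := by
    intro h hh
    obtain ⟨k, rfl⟩ := Nat.exists_eq_add_of_le (Nat.lt_succ_iff.mp (mem_range.mp hh))
    rw [show h + k + 1 - h = k + 1 by omega, show h + k + 1 - (h + 1) = k by omega,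
      Nat.add_sub_cancel_left, Nat.add_sub_cancel, smul_smul, smul_smul, ← add_smul]
    congr 1
    have h1 := halfCoeff_succ l h
    have h2 := halfCoeff_succ l k
    simp only [appellCoeff]
    push_cast
    linear_combination (k + 1) * halfCoeff l (k + 1) * h1 +
      (2 * (2 * l + 2 * (k + 1) + 1) + 2 * (2 * l + 2 * h + 1)) * halfCoeff l h * h2
  have hdiff : ∀ h ∈ range (m + 1),
      ((2 * l + 1 : ℝ) * (appellCoeff l h (m + 1 - h) - appellCoeff l (m + 1 - h) h)) •
        (a ^ h * geomSum a b (m + 1 - h)) =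
      ((h + 1 : ℕ) * halfCoeff l (h + 1) *
          ((m + 1 - (h + 1) + 1 : ℕ) * halfCoeff l (m + 1 - (h + 1) + 1)) -
        h * halfCoeff l h * ((m + 1 - h + 1 : ℕ) * halfCoeff l (m + 1 - h + 1))) •
        (a ^ h * geomSum a b (m + 1 - h)) := by
    intro h hh
    obtain ⟨k, rfl⟩ := Nat.exists_eq_add_of_le (Nat.lt_succ_iff.mp (mem_range.mp hh))
    rw [show h + k + 1 - h = k + 1 by omega, show h + k + 1 - (h + 1) = k by omega]
    congr 1
    have h1 := halfCoeff_succ l h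
    have h2 := halfCoeff_succ l (k + 1)
    simp only [appellCoeff]
    push_cast at h2 ⊢
    linear_combination -((k + 1) * halfCoeff l (k + 1)) * h1 + h * halfCoeff l h * h2
  calc _ = ∑ h ∈ range (m + 2), appellCoeff l h (m + 1 - h) •
          ((2 * (m + 1 - h : ℕ) : ℝ) • (a ^ h * b ^ (m + 1 - h - 1))) +
        (2 * l + 1 : ℝ) • (∑ h ∈ range (m + 2), appellCoeff l h (m + 1 - h) •
            (a ^ h * geomSum a b (m + 1 - h)) -
          ∑ h ∈ range (m + 2), appellCoeff l h (m + 1 - h) •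
            (a ^ (m + 1 - h) * geomSum a b h)) := by
        rw [← sum_sub_distrib, smul_sum, ← sum_add_distrib]
        refine sum_congr rfl fun h _ => ?_
        module
    _ = ∑ h ∈ range (m + 1), appellCoeff l h (m + 1 - h) •
          ((2 * (m + 1 - h : ℕ) : ℝ) • (a ^ h * b ^ (m + 1 - h - 1))) +
        ∑ h ∈ range (m + 1),
          ((2 * l + 1 : ℝ) * (appellCoeff l h (m + 1 - h) - appellCoeff l (m + 1 - h) h)) •
            (a ^ h * geomSum a b (m + 1 - h)) := by
        rw [hrefl, ← sum_sub_distrib, sum_range_succ, sum_range_succ _ (m + 1), Nat.sub_self]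
        simp only [geomSum, mul_zero, smul_zero, sub_zero, add_zero, Nat.cast_zero, zero_smul,
          smul_sum, ← sub_smul, smul_smul]
    _ = _ := by
        rw [sum_congr rfl hdiff, hparts, ← add_assoc, ← sum_add_distrib, sum_congr rfl hsplit,
          ← smul_sum, Nat.sub_self, geomSum, mul_zero, smul_zero, add_zero]

lemma pd_smul_sum {ι : Type*} (i : Fin 3) (s : Finset ι) (c : ℝ) (w : ι → ℝ) (f : ι → R3 → QH)
    (hf : ∀ j, Differentiable ℝ (f j)) (x : R3) :
    pd i (fun y => c • ∑ j ∈ s, w j • f j y) x = c • ∑ j ∈ s, w j • pd i (f j) x := by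
  unfold pd
  have hw : ∀ j ∈ s, HasFDerivAt (fun y => w j • f j y) (w j • fderiv ℝ (f j) x) x :=
    fun j _ => (hf j x).hasFDerivAt.const_smul (w j)
  rw [((HasFDerivAt.fun_sum hw).fun_const_smul c).fderiv]
  simp

lemma D0_smul_sum {ι : Type*} (s : Finset ι) (c : ℝ) (w : ι → ℝ) (f : ι → R3 → QH)
    (hf : ∀ j, Differentiable ℝ (f j)) (x : R3) :
    D0 (fun y => c • ∑ j ∈ s, w j • f j y) x = (c / 2) • ∑ j ∈ s, w j • Dadj (f j) x := by
  simp only [D0, Dadj, pd_smul_sum _ s c w f hf, smul_sub, sum_sub_distrib, mul_smul_comm,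
    mul_sum, smul_smul]
  ring_nf

lemma D0_appell (l m : ℕ) (x : R3) :
    D0 (appell (l + m) l) x =
      (((l + m).factorial * l.factorial : ℝ) /
        (2 ^ (2 * m) * (l + m + l + 1).factorial * (2 * l).factorial) / 2) •
      ((∑ h ∈ range (m + 1), appellCoeff l h (m - h) •
        ((2 * (m - h : ℕ) : ℝ) • (toQbar x ^ h * toQ x ^ (m - h - 1)) +
          (2 * l + 1 : ℝ) • (toQbar x ^ h * geomSum (toQbar x) (toQ x) (m - h)
            - toQbar x ^ (m - h) * geomSum (toQbar x) (toQ x) h))) * zeta x ^ l) := by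
  rw [appell_eq, D0_smul_sum _ _ _ (fun h y => toQbar y ^ h * (toQ y ^ (m - h) * zeta y ^ l))
    (fun h => differentiable_monomial h (m - h) l)]
  simp only [Dadj_monomial, sum_mul, smul_mul_assoc]

/-- the Appell property ∂₀A_n^l = n·A_{n-1}^l for 0 ≤ l ≤ n-1, n ≥ 1,
and ∂₀A_n^n = 0 for all n. -/
theorem appell_hypercomplex_derivative :
    (∀ n l : ℕ, 1 ≤ n → l ≤ n - 1 →
      ∀ x : R3, D0 (appell n l) x = (n : ℝ) • appell (n - 1) l x) ∧
    (∀ n : ℕ, ∀ x : R3, D0 (appell n n) x = 0) := by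
  refine ⟨fun n l hn hl x => ?_, fun n x => ?_⟩
  · obtain ⟨m, rfl⟩ : ∃ m, n = l + (m + 1) := ⟨n - 1 - l, by omega⟩
    rw [D0_appell, sum_geomSum, show l + (m + 1) - 1 = l + m by omega, appell_eq]
    simp only [← mul_assoc, ← smul_mul_assoc, ← sum_mul, smul_smul]
    congr 2
    rw [show l + (m + 1) + l + 1 = l + m + l + 1 + 1 by ring, ← add_assoc l m 1,
      Nat.factorial_succ (l + m), Nat.factorial_succ (l + m + l + 1)]
    push_cast
    field_simp
    ring
  · have h := D0_appell n 0 x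
    rw [add_zero] at h
    rw [h]
    simp [geomSum]
end
end

section
/- For all integers n ≥ 1 and 0 ≤ l ≤ n−1 and all x ∈ ℝ³, the two-step recurrence A_{n+1}^l(x) = ((n+1)/(2(n−l+1)(n+l+2)))·[((2n+3)·x + (2n+1)·x̄)·A_n^l(x) − 2n·x·x̄·A_{n−1}^l(x)] holds; moreover the initial elements satisfy A_{l+1}^l(x) = (1/4)·[(2l+3)·x + (2l+1)·x̄]·ζ^l and A_l^l(x) = ζ^l for every l ≥ 0, where ζ = x₁ − x₂e₃. -/
open MeasureTheory Metric Finset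

noncomputable section

/-- Cauchy product of two sequences with values in a ring. -/
def cauchyProd {A : Type*} [Ring A] (v u : ℕ → A) (m : ℕ) : A :=
  ∑ p ∈ antidiagonal m, v p.1 * u p.2

theorem cauchyProd_weight_right_succ {A : Type*} [Ring A] [Algebra ℝ A] {v u : ℕ → A} {a : A}
    {α : ℝ} (hav : ∀ i, Commute a (v i))
    (hu : ∀ k : ℕ, ((k : ℝ) + 1) • u (k + 1) = (4 * (k : ℝ) + α) • (a * u k)) (m : ℕ) :
    cauchyProd v (fun k => (k : ℝ) • u k) (m + 1) =
      a * ((4 : ℝ) • cauchyProd v (fun k => (k : ℝ) • u k) m + α • cauchyProd v u m) := by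
  unfold cauchyProd
  rw [Finset.Nat.sum_antidiagonal_succ', smul_sum, smul_sum, ← sum_add_distrib, mul_sum]
  simp only [Nat.cast_zero, zero_smul, mul_zero, zero_add, Nat.cast_add, Nat.cast_one]
  refine sum_congr rfl fun p _ => ?_
  rw [hu, mul_smul_comm, ← mul_assoc, ← (hav p.1).eq, mul_smul_comm, smul_smul, ← add_smul,
    mul_smul_comm, mul_assoc]

theorem cauchyProd_weight_left_succ {A : Type*} [Ring A] [Algebra ℝ A] {v u : ℕ → A} {b : A}
    {β : ℝ} (hv : ∀ k : ℕ, ((k : ℝ) + 1) • v (k + 1) = (4 * (k : ℝ) + β) • (b * v k)) (m : ℕ) :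
    cauchyProd (fun k => (k : ℝ) • v k) u (m + 1) =
      b * ((4 : ℝ) • cauchyProd (fun k => (k : ℝ) • v k) u m + β • cauchyProd v u m) := by
  unfold cauchyProd
  rw [Finset.Nat.sum_antidiagonal_succ, smul_sum, smul_sum, ← sum_add_distrib, mul_sum]
  simp only [Nat.cast_zero, zero_smul, zero_mul, zero_add, Nat.cast_add, Nat.cast_one]
  refine sum_congr rfl fun p _ => ?_
  rw [hv, smul_mul_assoc, smul_mul_assoc, smul_smul, ← add_smul, mul_smul_comm, mul_assoc]

theorem cauchyProd_weight_add {A : Type*} [Ring A] [Algebra ℝ A] (v u : ℕ → A) (m : ℕ) :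
    cauchyProd v (fun k => (k : ℝ) • u k) m + cauchyProd (fun k => (k : ℝ) • v k) u m =
      (m : ℝ) • cauchyProd v u m := by
  unfold cauchyProd
  rw [smul_sum, ← sum_add_distrib]
  refine sum_congr rfl fun p hp => ?_
  rw [← mem_antidiagonal.mp hp, mul_smul_comm, smul_mul_assoc, ← add_smul, Nat.cast_add, add_comm]

/-- Three-term recurrence for the Cauchy product of two sequences with hypergeometric
one-step recurrences. -/
theorem cauchyProd_three_term {A : Type*} [Ring A] [Algebra ℝ A] {v u : ℕ → A} {a b : A}
    {α β : ℝ} (hab : Commute a b) (hav : ∀ i, Commute a (v i))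
    (hu : ∀ k : ℕ, ((k : ℝ) + 1) • u (k + 1) = (4 * (k : ℝ) + α) • (a * u k))
    (hv : ∀ k : ℕ, ((k : ℝ) + 1) • v (k + 1) = (4 * (k : ℝ) + β) • (b * v k)) (m : ℕ) :
    ((m : ℝ) + 2) • cauchyProd v u (m + 2) =
      ((4 * ((m : ℝ) + 1) + α) • a + (4 * ((m : ℝ) + 1) + β) • b) * cauchyProd v u (m + 1)
        - (4 * (4 * (m : ℝ) + α + β)) • (a * (b * cauchyProd v u m)) := by
  have hU := cauchyProd_weight_right_succ hav hu
  have hV := cauchyProd_weight_left_succ (u := u) hv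
  have hUV := cauchyProd_weight_add v u
  have hcast : (m : ℝ) + 2 = ((m + 2 : ℕ) : ℝ) := by push_cast; ring
  have hU1 := eq_sub_of_add_eq (hUV (m + 1))
  have hV1 := eq_sub_of_add_eq' (hUV (m + 1))
  rw [hV] at hU1
  rw [hU] at hV1
  rw [hcast, ← hUV, hU, hV, hU1, hV1, eq_sub_of_add_eq (hUV m)]
  have hba (y : A) : b * (a * y) = a * (b * y) := by rw [← mul_assoc, ← hab.eq, mul_assoc]
  simp only [mul_add, add_mul, mul_sub, smul_add, smul_sub, mul_smul_comm, smul_mul_assoc, hba]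
  push_cast
  module

/-- Coefficient of `xᵏ` in the first factor of the generating function of the Appell
polynomials. -/
def oddCoeff (l k : ℕ) : ℝ :=
  ((2 * l + 2 * k + 1).factorial : ℝ) / (k.factorial * (l + k).factorial)

/-- Coefficient of `x̄ʰ` in the second factor of the generating function of the Appell
polynomials. -/
def evenCoeff (l h : ℕ) : ℝ :=
  ((2 * l + 2 * h).factorial : ℝ) / (h.factorial * (l + h).factorial)

theorem oddCoeff_succ (l k : ℕ) :
    ((k : ℝ) + 1) * oddCoeff l (k + 1) = (4 * (k : ℝ) + (4 * l + 6)) * oddCoeff l k := by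
  unfold oddCoeff
  rw [show 2 * l + 2 * (k + 1) + 1 = 2 * l + 2 * k + 1 + 1 + 1 by ring, ← add_assoc l k 1]
  simp only [Nat.factorial_succ (2 * l + 2 * k + 1 + 1), Nat.factorial_succ (2 * l + 2 * k + 1),
    Nat.factorial_succ k, Nat.factorial_succ (l + k)]
  push_cast
  field_simp
  ring

theorem evenCoeff_succ (l h : ℕ) :
    ((h : ℝ) + 1) * evenCoeff l (h + 1) = (4 * (h : ℝ) + (4 * l + 2)) * evenCoeff l h := by
  unfold evenCoeff
  rw [show 2 * l + 2 * (h + 1) = 2 * l + 2 * h + 1 + 1 by ring, ← add_assoc l h 1]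
  simp only [Nat.factorial_succ (2 * l + 2 * h + 1), Nat.factorial_succ (2 * l + 2 * h),
    Nat.factorial_succ h, Nat.factorial_succ (l + h)]
  push_cast
  field_simp
  ring

/-- The sum in the definition of the Appell polynomial `A_{l+m}^l`. -/
def appellSum (l m : ℕ) (x : R3) : QH :=
  cauchyProd (fun h => evenCoeff l h • toQbar x ^ h) (fun k => oddCoeff l k • toQ x ^ k) m

/-- The normalising factor of the Appell polynomial `A_{l+m}^l`. -/
def appellScale (l m : ℕ) : ℝ :=
  ((l + m).factorial * l.factorial : ℝ) /
    (4 ^ m * (2 * l + m + 1).factorial * (2 * l).factorial)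

theorem appell_add_eq (l m : ℕ) (x : R3) :
    appell (l + m) l x = appellScale l m • (appellSum l m x * zeta x ^ l) := by
  unfold appell appellSum appellScale cauchyProd
  rw [Nat.sum_antidiagonal_eq_sum_range_succ_mk, add_tsub_cancel_left, pow_mul,
    show l + m + l + 1 = 2 * l + m + 1 by ring]
  norm_num only
  congr 2
  refine sum_congr rfl fun h hh => ?_
  obtain ⟨k, rfl⟩ := Nat.exists_eq_add_of_le (Nat.lt_succ_iff.mp (mem_range.mp hh))
  rw [smul_mul_smul_comm, evenCoeff, oddCoeff, add_tsub_cancel_left,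
    show l + (h + k) - h = l + k by omega,
    show 2 * (l + (h + k)) - 2 * h + 1 = 2 * l + 2 * k + 1 by omega]
  congr 1
  field_simp

theorem appellScale_succ (l m : ℕ) :
    appellScale l (m + 1) =
      ((l : ℝ) + m + 1) / (4 * (2 * (l : ℝ) + m + 2)) * appellScale l m := by
  unfold appellScale
  rw [← add_assoc l m 1, show 2 * l + (m + 1) + 1 = 2 * l + m + 1 + 1 by ring,
    Nat.factorial_succ (l + m), Nat.factorial_succ (2 * l + m + 1), pow_succ]
  push_cast
  field_simp
  ring

theorem commute_toQ_toQbar (x : R3) : Commute (toQ x) (toQbar x) := by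
  have h : toQbar x = star (toQ x) := by
    ext
    · rw [Quaternion.re_star]; rfl
    · rw [Quaternion.imI_star]; rfl
    · rw [Quaternion.imJ_star]; rfl
    · rw [Quaternion.imK_star]; exact neg_zero.symm
  rw [h]
  exact (star_comm_self (x := toQ x)).symm

theorem appellSum_three_term (l m : ℕ) (x : R3) :
    ((m : ℝ) + 2) • appellSum l (m + 2) x =
      ((4 * ((m : ℝ) + 1) + (4 * l + 6)) • toQ x + (4 * ((m : ℝ) + 1) + (4 * l + 2)) • toQbar x)
          * appellSum l (m + 1) x
        - (4 * (4 * (m : ℝ) + (4 * l + 6) + (4 * l + 2))) •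
          (toQ x * (toQbar x * appellSum l m x)) := by
  refine cauchyProd_three_term (commute_toQ_toQbar x)
    (fun i => ((commute_toQ_toQbar x).pow_right i).smul_right _) (fun k => ?_) (fun k => ?_) m
  · rw [smul_smul, oddCoeff_succ, mul_smul_comm, smul_smul, pow_succ']
  · rw [smul_smul, evenCoeff_succ, mul_smul_comm, smul_smul, pow_succ']

theorem appellScale_zero_mul (l : ℕ) :
    appellScale l 0 * (evenCoeff l 0 * oddCoeff l 0) = 1 := by
  simp only [appellScale, evenCoeff, oddCoeff, mul_zero, add_zero, pow_zero, Nat.factorial_zero]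
  push_cast
  field_simp

theorem appell_self (l : ℕ) (x : R3) : appell l l x = zeta x ^ l := by
  have h := appell_add_eq l 0 x
  simp only [add_zero, appellSum, cauchyProd, Finset.Nat.antidiagonal_zero, sum_singleton, pow_zero,
    smul_mul_smul_comm, mul_one] at h
  rw [h, smul_mul_assoc, one_mul, smul_smul, appellScale_zero_mul, one_smul]

theorem appell_succ_self (l : ℕ) (x : R3) :
    appell (l + 1) l x =
      (1 / 4 : ℝ) • (((2 * (l : ℝ) + 3) • toQ x + (2 * (l : ℝ) + 1) • toQbar x)
        * zeta x ^ l) := by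
  have hodd : oddCoeff l 1 = (4 * l + 6) * oddCoeff l 0 := by simpa using oddCoeff_succ l 0
  have heven : evenCoeff l 1 = (4 * l + 2) * evenCoeff l 0 := by simpa using evenCoeff_succ l 0
  have hscale := appellScale_succ l 0
  rw [appell_add_eq, appellSum, cauchyProd,
    Finset.Nat.sum_antidiagonal_succ (n := 0), Finset.Nat.antidiagonal_zero, sum_singleton]
  simp only [zero_add, pow_zero, pow_one, smul_mul_smul_comm, one_mul, mul_one, hodd, heven]
  rw [← smul_mul_assoc, ← smul_mul_assoc, smul_add, smul_add]
  simp only [smul_smul]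
  have hone := appellScale_zero_mul l
  have hl : (2 * (l : ℝ) + 2) ≠ 0 := by positivity
  have hs : appellScale l 1 * (evenCoeff l 0 * oddCoeff l 0) = 1 / 8 := by
    rw [← zero_add 1, hscale, mul_assoc, hone]
    push_cast
    field_simp
    ring
  congr 3
  · linear_combination (4 * (l : ℝ) + 6) * hs
  · linear_combination (4 * (l : ℝ) + 2) * hs

theorem appell_add_two (l m : ℕ) (x : R3) :
    appell (l + (m + 2)) l x =
      (((l : ℝ) + m + 2) / (2 * ((m : ℝ) + 2) * (2 * (l : ℝ) + m + 3))) •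
        ((((2 * (l : ℝ) + 2 * m + 5) • toQ x + (2 * (l : ℝ) + 2 * m + 3) • toQbar x)
            * appell (l + (m + 1)) l x)
          - (2 * ((l : ℝ) + m + 1)) • (toQ x * (toQbar x * appell (l + m) l x))) := by
  have hm : (m : ℝ) + 2 ≠ 0 := by positivity
  have hsum := (eq_inv_smul_iff₀ hm).mpr (appellSum_three_term l m x)
  have h1 : (2 * (l : ℝ) + m + 2) ≠ 0 := by positivity
  have h2 : (2 * (l : ℝ) + m + 3) ≠ 0 := by positivity
  have hscale := appellScale_succ l (m + 1)
  have hscale' := appellScale_succ l m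
  rw [appell_add_eq, appell_add_eq, appell_add_eq, hsum, hscale, hscale']
  simp only [mul_add, add_mul, sub_mul, smul_add, smul_sub, mul_smul_comm,
    smul_mul_assoc, mul_assoc, smul_smul]
  push_cast
  match_scalars <;> field_simp <;> ring

/-- the two-step recurrence for the Appell basis, with its initial elements. -/
theorem appell_two_step_recurrence :
    (∀ n l : ℕ, 1 ≤ n → l ≤ n - 1 → ∀ x : R3,
      appell (n + 1) l x =
        (((n : ℝ) + 1) / (2 * ((n : ℝ) - l + 1) * ((n : ℝ) + l + 2))) •
          ((((2 * (n : ℝ) + 3) • toQ x + (2 * (n : ℝ) + 1) • toQbar x) * appell n l x)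
            - (2 * (n : ℝ)) • (toQ x * (toQbar x * appell (n - 1) l x)))) ∧
    (∀ l : ℕ, ∀ x : R3,
      appell (l + 1) l x =
        (1 / 4 : ℝ) • (((2 * (l : ℝ) + 3) • toQ x + (2 * (l : ℝ) + 1) • toQbar x)
          * zeta x ^ l)) ∧
    (∀ l : ℕ, ∀ x : R3, appell l l x = zeta x ^ l) := by
  refine ⟨fun n l hn hl x => ?_, appell_succ_self, appell_self⟩
  obtain ⟨m, rfl⟩ : ∃ m, n = l + (m + 1) := ⟨n - 1 - l, by omega⟩
  have h := appell_add_two l m x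
  rw [show l + (m + 1) + 1 = l + (m + 2) by ring, show l + (m + 1) - 1 = l + m by omega, h]
  push_cast
  congr 2 <;> ring_nf
end
end
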